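/- Let n ≥ 3, σ > 0, A_σ = I − σL with L the discrete periodic Laplacian, and B = diag(1, …, 1, −1) ∈ ℝ^{n×n}. Then all n eigenvalues of A_σ^{-1}B (counted with multiplicity) are real, none is zero, every eigenvalue lies in [−1, 1], exactly one eigenvalue is negative, and the remaining n − 1 eigenvalues (with multiplicity) are positive. Ordering the eigenvalues λ₁ ≥ λ₂ ≥ … ≥ λₙ, this says 1 ≥ λ₁ ≥ … ≥ λ_{n−1} > 0 > λₙ ≥ −1. -/

import Mathlib

open Matrix Polynomial

/-- The discrete one-dimensional Laplacian with periodic boundary conditions: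
the circulant matrix whose first column is `(-2, 1, 0, …, 0, 1)ᵀ`. -/
noncomputable def Lmat (n : ℕ) : Matrix (Fin n) (Fin n) ℝ :=
  Matrix.circulant (fun i : Fin n =>
    if (i : ℕ) = 0 then -2 else if (i : ℕ) = 1 ∨ (i : ℕ) = n - 1 then 1 else 0)

/-- The Laplacian smoothing matrix `A_σ = I - σ L`. -/
noncomputable def Amat (n : ℕ) (σ : ℝ) : Matrix (Fin n) (Fin n) ℝ :=
  1 - σ • Lmat n

/-- The matrix `B = diag(1, …, 1, -1)`. -/
noncomputable def Bmat (n : ℕ) : Matrix (Fin n) (Fin n) ℝ :=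
  Matrix.diagonal (fun i : Fin n => if (i : ℕ) = n - 1 then -1 else 1)

open scoped MatrixOrder in
/-- A positive definite matrix is congruent to the identity. -/
lemma exists_inv_eq_mul_transpose {ι : Type*} [Fintype ι] [DecidableEq ι]
    {A : Matrix ι ι ℝ} (hA : A.PosDef) :
    ∃ S : Matrix ι ι ℝ, A⁻¹ = S * Sᵀ ∧ Sᵀ * A * S = 1 := by
  obtain ⟨C, hC⟩ := CStarAlgebra.nonneg_iff_eq_star_mul_self.mp hA.posSemidef.nonneg
  rw [star_eq_conjTranspose, conjTranspose_eq_transpose_of_trivial] at hC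
  have hdet : IsUnit C.det := by
    have h := hA.det_pos.ne'
    rw [hC, det_mul, det_transpose] at h
    exact isUnit_iff_ne_zero.mpr (left_ne_zero_of_mul h)
  refine ⟨C⁻¹, ?_, ?_⟩
  · rw [hC, Matrix.mul_inv_rev, transpose_nonsing_inv]
  · rw [hC, transpose_nonsing_inv, ← Matrix.mul_assoc,
      nonsing_inv_mul _ (by rwa [det_transpose]), Matrix.one_mul, mul_nonsing_inv _ hdet]

lemma dotProduct_transpose_mul_mul_mulVec {ι : Type*} [Fintype ι]
    (M S : Matrix ι ι ℝ) (u v : ι → ℝ) :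
    u ⬝ᵥ ((Sᵀ * M * S) *ᵥ v) = (S *ᵥ u) ⬝ᵥ (M *ᵥ (S *ᵥ v)) := by
  rw [← mulVec_mulVec, ← mulVec_mulVec, dotProduct_mulVec, vecMul_transpose]

lemma transpose_one_sub_permMatrix_finRotate_mul_self (m : ℕ) :
    (1 - (finRotate (m + 3)).permMatrix ℝ)ᵀ * (1 - (finRotate (m + 3)).permMatrix ℝ)
      = -Lmat (m + 3) := by
  have h : (1 - (finRotate (m + 3)).permMatrix ℝ)ᵀ * (1 - (finRotate (m + 3)).permMatrix ℝ)
      = 2 - (finRotate (m + 3)).permMatrix ℝ - ((finRotate (m + 3)).permMatrix ℝ)ᵀ := by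
    have : ((finRotate (m + 3)).permMatrix ℝ)ᵀ * (finRotate (m + 3)).permMatrix ℝ = 1 := by
      rw [transpose_permMatrix, ← Matrix.permMatrix_mul]
      simp
    rw [transpose_sub, transpose_one, Matrix.sub_mul, Matrix.mul_sub, Matrix.mul_sub, this]
    simp only [Matrix.mul_one, Matrix.one_mul]
    rw [← one_add_one_eq_two]
    abel
  rw [h]
  ext i j
  have h2 : (2 : Matrix (Fin (m + 3)) (Fin (m + 3)) ℝ) i j = if i = j then 2 else 0 := by
    rw [← one_add_one_eq_two, Matrix.add_apply, one_apply]
    split_ifs <;> norm_num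
  simp only [Matrix.sub_apply, h2, transpose_apply, Equiv.Perm.permMatrix, Equiv.toPEquiv_apply,
    PEquiv.toMatrix_apply, Option.mem_def, Option.some.injEq, finRotate_apply,
    Lmat, circulant_apply, Matrix.neg_apply]
  have hij : ((i - j : Fin (m + 3)) : ℕ) = if j ≤ i then (i : ℕ) - j else m + 3 + i - j := by
    split_ifs with h
    · exact Fin.sub_val_of_le h
    · rw [Fin.coe_sub_iff_lt.mpr (not_le.mp h)]
  have hi := Fin.val_add_one i
  have hj := Fin.val_add_one j
  simp only [hij, Fin.ext_iff, Fin.le_def, Fin.val_last] at hi hj ⊢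
  simp only [hi, hj]
  have := i.2
  have := j.2
  split_ifs <;> first | (exfalso; omega) | norm_num

lemma Amat_eq_one_add (m : ℕ) (σ : ℝ) : ∃ D : Matrix (Fin (m + 3)) (Fin (m + 3)) ℝ,
    Amat (m + 3) σ = 1 + σ • (Dᵀ * D) :=
  ⟨_, by rw [transpose_one_sub_permMatrix_finRotate_mul_self, Amat, smul_neg, sub_eq_add_neg]⟩

lemma Amat_posDef_and_dotProduct_le (n : ℕ) (hn : 3 ≤ n) (σ : ℝ) (hσ : 0 < σ) :
    (Amat n σ).PosDef ∧ ∀ y, y ⬝ᵥ y ≤ y ⬝ᵥ (Amat n σ *ᵥ y) := by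
  obtain ⟨m, rfl⟩ := Nat.exists_eq_add_of_le' hn
  obtain ⟨D, hD⟩ := Amat_eq_one_add m σ
  have hpsd : (σ • (Dᵀ * D)).PosSemidef := by
    simpa using (posSemidef_conjTranspose_mul_self D).smul hσ.le
  rw [hD]
  refine ⟨PosDef.one.add_posSemidef hpsd, fun y => ?_⟩
  rw [add_mulVec, one_mulVec, dotProduct_add]
  simpa using hpsd.dotProduct_mulVec_nonneg y

lemma dotProduct_Bmat_mulVec (n : ℕ) (y : Fin n → ℝ) :
    y ⬝ᵥ (Bmat n *ᵥ y) = ∑ i : Fin n, (if (i : ℕ) = n - 1 then -1 else 1) * y i ^ 2 := by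
  simp only [dotProduct, Bmat, mulVec_diagonal]
  exact Finset.sum_congr rfl fun i _ => by ring

lemma abs_dotProduct_Bmat_mulVec_le (n : ℕ) (y : Fin n → ℝ) :
    |y ⬝ᵥ (Bmat n *ᵥ y)| ≤ y ⬝ᵥ y := by
  rw [dotProduct_Bmat_mulVec]
  refine (Finset.abs_sum_le_sum_abs _ _).trans (le_of_eq (Finset.sum_congr rfl fun i _ => ?_))
  split_ifs <;> simp [abs_mul, sq]

lemma dotProduct_Bmat_mulVec_nonneg (n : ℕ) (y : Fin n → ℝ)
    (hy : ∀ i : Fin n, (i : ℕ) = n - 1 → y i = 0) : 0 ≤ y ⬝ᵥ (Bmat n *ᵥ y) := by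
  rw [dotProduct_Bmat_mulVec]
  refine Finset.sum_nonneg fun i _ => ?_
  split_ifs with h
  · simp [hy i h]
  · positivity

lemma det_Bmat (n : ℕ) (hn : 0 < n) : (Bmat n).det = -1 := by
  obtain ⟨m, rfl⟩ := Nat.exists_eq_add_of_le' hn
  rw [Bmat, det_diagonal, Fin.prod_univ_castSucc]
  rw [Finset.prod_eq_one fun i _ => if_neg (by have := i.2; simp; omega)]
  simp

theorem stmt3 (n : ℕ) (hn : 3 ≤ n) (σ : ℝ) (hσ : 0 < σ) :
    -- all `n` eigenvalues of `A_σ⁻¹ B`, counted with multiplicity, are real: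
    Multiset.card (((Amat n σ)⁻¹ * Bmat n).charpoly.roots) = n ∧
      -- none is zero and every eigenvalue lies in `[-1, 1]`:
      (∀ μ ∈ ((Amat n σ)⁻¹ * Bmat n).charpoly.roots, μ ≠ 0 ∧ μ ∈ Set.Icc (-1 : ℝ) 1) ∧
      -- exactly one eigenvalue is negative:
      Multiset.card ((((Amat n σ)⁻¹ * Bmat n).charpoly.roots).filter (fun μ => μ < 0)) = 1 ∧
      -- and the remaining `n - 1` eigenvalues (with multiplicity) are positive:
      Multiset.card ((((Amat n σ)⁻¹ * Bmat n).charpoly.roots).filter (fun μ => 0 < μ)) = n - 1 := by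
  obtain ⟨hA, hle⟩ := Amat_posDef_and_dotProduct_le n hn σ hσ
  obtain ⟨S, hAS, hS⟩ := exists_inv_eq_mul_transpose hA
  have hH : (Sᵀ * Bmat n * S).IsHermitian := by
    rw [IsHermitian, conjTranspose_eq_transpose_of_trivial]
    simp [Bmat, transpose_mul, Matrix.mul_assoc]
  have hroots : ((Amat n σ)⁻¹ * Bmat n).charpoly.roots
      = Multiset.map hH.eigenvalues Finset.univ.val := by
    rw [hAS, Matrix.mul_assoc, charpoly_mul_comm]
    simpa using hH.roots_charpoly_eq_eigenvalues
  have hdet : ∏ i, hH.eigenvalues i < 0 := by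
    have h1 : (Sᵀ * Bmat n * S).det = ∏ i, hH.eigenvalues i := by
      simpa using hH.det_eq_prod_eigenvalues
    have h2 : S.det * S.det = (Amat n σ)⁻¹.det := by rw [hAS, det_mul, det_transpose]
    have h3 := hA.inv.det_pos
    rw [← h1, det_mul, det_mul, det_transpose, det_Bmat n (by omega)]
    linarith
  have hne (i) : hH.eigenvalues i ≠ 0 := Finset.prod_ne_zero_iff.mp hdet.ne i (Finset.mem_univ i)
  have hdot (i j) : (hH.eigenvectorBasis i).ofLp ⬝ᵥ (hH.eigenvectorBasis j).ofLp
      = if i = j then 1 else 0 := by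
    have h := orthonormal_iff_ite.mp hH.eigenvectorBasis.orthonormal i j
    rw [← h, EuclideanSpace.inner_eq_star_dotProduct, dotProduct_comm]
    simp
  have hform (i j) : (hH.eigenvectorBasis i).ofLp ⬝ᵥ
      ((Sᵀ * Bmat n * S) *ᵥ (hH.eigenvectorBasis j).ofLp)
      = if i = j then hH.eigenvalues j else 0 := by
    rw [hH.mulVec_eigenvectorBasis, dotProduct_smul, hdot]
    simp
  have hbound (i) : |hH.eigenvalues i| ≤ 1 := by
    have h1 := hform i i
    have h2 : (hH.eigenvectorBasis i).ofLp ⬝ᵥ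
        ((Sᵀ * Amat n σ * S) *ᵥ (hH.eigenvectorBasis i).ofLp) = 1 := by
      rw [hS, one_mulVec, hdot, if_pos rfl]
    rw [dotProduct_transpose_mul_mul_mulVec] at h1 h2
    rw [if_pos rfl] at h1
    rw [← h1, ← h2]
    exact (abs_dotProduct_Bmat_mulVec_le n _).trans (hle _)
  have huniq (i j) (hi : hH.eigenvalues i < 0) (hj : hH.eigenvalues j < 0) : i = j := by
    by_contra hij
    let l : Fin n := ⟨n - 1, by omega⟩
    have key (a b : ℝ) (hab : (S *ᵥ (a • (hH.eigenvectorBasis i).ofLp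
        + b • (hH.eigenvectorBasis j).ofLp)) l = 0) :
        0 ≤ a ^ 2 * hH.eigenvalues i + b ^ 2 * hH.eigenvalues j := by
      have h := dotProduct_Bmat_mulVec_nonneg n (S *ᵥ (a • (hH.eigenvectorBasis i).ofLp
        + b • (hH.eigenvectorBasis j).ofLp)) (fun k hk => by
          rwa [show k = l from Fin.ext hk])
      rw [← dotProduct_transpose_mul_mul_mulVec] at h
      simp only [mulVec_add, mulVec_smul, dotProduct_add, add_dotProduct, dotProduct_smul,
        smul_dotProduct, hform, if_neg hij, if_neg (Ne.symm hij), if_true, smul_eq_mul] at h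
      linarith
    set a := (S *ᵥ (hH.eigenvectorBasis i).ofLp) l with ha
    set b := (S *ᵥ (hH.eigenvectorBasis j).ofLp) l with hb
    by_cases ha0 : a = 0
    · have := key 1 0 (by simp [← ha, ha0])
      linarith
    · have h := key b (-a) (by
        simp only [mulVec_add, mulVec_smul, Pi.add_apply, Pi.smul_apply, ← ha, ← hb, smul_eq_mul]
        ring)
      have : 0 < a ^ 2 := by positivity
      nlinarith [sq_nonneg b]
  have hneg : (Finset.univ.filter fun i => hH.eigenvalues i < 0).card = 1 := by
    refine le_antisymm (Finset.card_le_one.mpr fun i hi j hj =>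
      huniq i j (Finset.mem_filter.mp hi).2 (Finset.mem_filter.mp hj).2) ?_
    rw [Nat.one_le_iff_ne_zero, Finset.card_ne_zero]
    by_contra hempty
    rw [Finset.not_nonempty_iff_eq_empty, Finset.filter_eq_empty_iff] at hempty
    exact hdet.not_ge (Finset.prod_nonneg fun i hi => not_lt.mp (hempty hi))
  have hpos : (Finset.univ.filter fun i => 0 < hH.eigenvalues i).card = n - 1 := by
    have h := Finset.card_filter_add_card_filter_not (s := Finset.univ)
      (fun i => hH.eigenvalues i < 0)
    rw [hneg, Finset.card_univ, Fintype.card_fin] at h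
    have h' : (Finset.univ.filter fun i => ¬ hH.eigenvalues i < 0)
        = Finset.univ.filter fun i => 0 < hH.eigenvalues i :=
      Finset.filter_congr fun i _ => not_lt.trans (hne i).symm.le_iff_lt
    rw [h'] at h
    omega
  rw [hroots]
  refine ⟨by simp, fun μ hμ => ?_, ?_, ?_⟩
  · obtain ⟨i, -, rfl⟩ := Multiset.mem_map.mp hμ
    exact ⟨hne i, abs_le.mp (hbound i)⟩
  · rw [Multiset.filter_map, Multiset.card_map]
    exact hneg
  · rw [Multiset.filter_map, Multiset.card_map]
    exact hpos
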